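/- arXiv:2405.19965 — 2 statements merged into one kernel-verified Lean document; each statement's English description precedes it below -/
import Mathlib

section
/- Let q ≥ 3 be a power of an odd prime, let m ≥ 7 with m ≡ 1 (mod 3), and n = (q^m−1)/2. For 2 ≤ i ≤ 6, the i-th largest odd q-cyclotomic coset leader modulo 2n is δ_i′ = q^m − q^{m−1} − q^{(2m+1)/3 + ε} − q^{(m−1)/3 + ζ} − 1, where ε = −1 if i = 2 and ε = 0 if 3 ≤ i ≤ 6, and ζ = 0 if i = 2 and ζ = i−4 if 3 ≤ i ≤ 6. Moreover, for 4 ≤ i ≤ 6 the q-cyclotomic coset C_{δ_i′}^{2n} has exactly m elements. -/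
open Finset

/-- The `q`-cyclotomic coset of `i` modulo `N`, as a subset of `ZMod N`. -/
def qCoset (q N i : ℕ) : Set (ZMod N) :=
  Set.range fun j : ℕ => (i : ZMod N) * (q : ZMod N) ^ j

/-- The odd `q`-cyclotomic coset leaders modulo `N`. -/
noncomputable def oddLeaders (q N : ℕ) : Finset ℕ := by
  classical
  exact (Finset.range N).filter fun s => Odd s ∧ ∀ j : ℕ, s ≤ (s * q ^ j) % N

/-- `x` is the `i`-th largest element of the finite set `S` (1-indexed). -/
def IsIthLargest (S : Finset ℕ) (i x : ℕ) : Prop :=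
  x ∈ S ∧ (S.filter fun y => x ≤ y).card = i

/-- Evaluation of the polynomial with coefficient vector `c` at the point `x`
of an extension field. -/
noncomputable def evalAt (F : Type*) {E : Type*} [Field F] [Field E] [Algebra F E]
    (n : ℕ) (x : E) : (Fin n → F) →ₗ[F] E where
  toFun c := ∑ j : Fin n, c j • x ^ (j : ℕ)
  map_add' a b := by simp [add_smul, Finset.sum_add_distrib]
  map_smul' r a := by simp [Finset.smul_sum, smul_smul]

/-- The negacyclic BCH code `C_(n,-1,δ,b)`: all words whose polynomial vanishes at
`γ^(1+2i)` for `b ≤ i ≤ b+δ-2`, where `γ` is a primitive `2n`-th root of unity. -/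
noncomputable def negaBCH (F : Type*) {E : Type*} [Field F] [Field E] [Algebra F E]
    (n : ℕ) (γ : E) (δ b : ℕ) : Submodule F (Fin n → F) :=
  ⨅ i ∈ Finset.Icc b (b + δ - 2), LinearMap.ker (evalAt F n (γ ^ (1 + 2 * i)))

/-- The cyclic BCH code `C_(n,1,δ,b)`: all words whose polynomial vanishes at
`β^i` for `b ≤ i ≤ b+δ-2`, where `β` is a primitive `n`-th root of unity. -/
noncomputable def cyclicBCH (F : Type*) {E : Type*} [Field F] [Field E] [Algebra F E]
    (n : ℕ) (β : E) (δ b : ℕ) : Submodule F (Fin n → F) :=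
  ⨅ i ∈ Finset.Icc b (b + δ - 2), LinearMap.ker (evalAt F n (β ^ i))

/-- The dual code under the standard inner product. -/
def dualCode {F : Type*} [Field F] {n : ℕ} (C : Submodule F (Fin n → F)) :
    Submodule F (Fin n → F) where
  carrier := {y | ∀ c ∈ C, ∑ j, y j * c j = 0}
  add_mem' := by
    intro a b ha hb c hc
    simp only [Set.mem_setOf_eq] at *
    simp [Pi.add_apply, add_mul, Finset.sum_add_distrib, ha c hc, hb c hc]
  zero_mem' := by intro c hc; simp
  smul_mem' := by
    intro r y hy c hc
    simp only [Set.mem_setOf_eq] at *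
    simp [Pi.smul_apply, smul_eq_mul, mul_assoc, ← Finset.mul_sum, hy c hc]

/-- The extended code of a code of length `n`. -/
def extendedCode {F : Type*} [Field F] {n : ℕ} (C : Submodule F (Fin n → F)) :
    Submodule F (Fin (n + 1) → F) where
  carrier := {x | (fun j : Fin n => x j.castSucc) ∈ C ∧ ∑ i, x i = 0}
  add_mem' := by
    intro a b ha hb
    exact ⟨C.add_mem ha.1 hb.1, by simp [Finset.sum_add_distrib, ha.2, hb.2]⟩
  zero_mem' := ⟨C.zero_mem, by simp⟩
  smul_mem' := by
    intro r x hx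
    exact ⟨C.smul_mem r hx.1, by simp [← Finset.mul_sum, hx.2]⟩

/-- Hamming weight of a word. -/
noncomputable def hWt {F : Type*} [Field F] {n : ℕ} (c : Fin n → F) : ℕ := by
  classical exact hammingNorm c

/-- `d` is the minimum Hamming distance of the code `C`. -/
def minDistIs {F : Type*} [Field F] {n : ℕ} (C : Submodule F (Fin n → F)) (d : ℕ) : Prop :=
  IsLeast {w : ℕ | ∃ c ∈ C, c ≠ 0 ∧ hWt c = w} d

theorem pow_add_pow_lt {q x y a : ℕ} (hq : 3 ≤ q) (hx : x < a) (hy : y < a) :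
    q ^ x + q ^ y < q ^ a := by
  obtain ⟨c, rfl⟩ : ∃ c, a = c + 1 := ⟨a - 1, by omega⟩
  have h1 : q ^ x ≤ q ^ c := Nat.pow_le_pow_right (by omega) (by omega)
  have h2 : q ^ y ≤ q ^ c := Nat.pow_le_pow_right (by omega) (by omega)
  have h3 : 0 < q ^ c := by positivity
  rw [pow_succ]
  nlinarith

theorem pow_add_pow_add_pow_le {q x y z a : ℕ} (hq : 3 ≤ q) (hx : x < a) (hy : y < a)
    (hz : z < a) : q ^ x + q ^ y + q ^ z ≤ q ^ a := by
  obtain ⟨c, rfl⟩ : ∃ c, a = c + 1 := ⟨a - 1, by omega⟩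
  have h1 : q ^ x ≤ q ^ c := Nat.pow_le_pow_right (by omega) (by omega)
  have h2 : q ^ y ≤ q ^ c := Nat.pow_le_pow_right (by omega) (by omega)
  have h3 : q ^ z ≤ q ^ c := Nat.pow_le_pow_right (by omega) (by omega)
  have h4 : q ^ c * 3 ≤ q ^ c * q := Nat.mul_le_mul_left _ hq
  rw [pow_succ]
  omega

theorem coprime_of_add_one_eq_pow {q m M : ℕ} (hm : m ≠ 0) (hM : M + 1 = q ^ m) :
    Nat.Coprime M q := by
  have h : Nat.Coprime M (M + 1) := by simp
  rw [hM] at h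
  exact (Nat.coprime_pow_right_iff (Nat.pos_of_ne_zero hm) _ _).1 h

theorem pow_modEq_pow_mod {q m M : ℕ} (hM : M + 1 = q ^ m) (j : ℕ) :
    q ^ j ≡ q ^ (j % m) [MOD M] := by
  have h1 : q ^ m ≡ 1 [MOD M] := by
    rw [← hM]; simp [Nat.ModEq]
  conv_lhs => rw [← Nat.div_add_mod j m, pow_add, pow_mul]
  simpa using (h1.pow (j / m)).mul_right (q ^ (j % m))

theorem mod_eq_sub_mod {M x y : ℕ} (h : M ∣ x + y) (hM : 0 < M) (hx : 0 < x % M) :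
    y % M = M - x % M := by
  have h1 := Nat.mod_lt x hM
  have h2 := Nat.mod_lt y hM
  have h3 : (x % M + y % M) % M = 0 := by
    rw [← Nat.add_mod]; exact Nat.mod_eq_zero_of_dvd h
  obtain ⟨c, hc⟩ := Nat.dvd_of_mod_eq_zero h3
  have : c = 1 := by
    rcases Nat.lt_trichotomy c 1 with h | h | h
    · have : c = 0 := by omega
      subst this; omega
    · exact h
    · nlinarith
  subst this
  omega

/-- `t` is the largest element of its `q`-cyclotomic coset modulo `M`. -/
def IsCosetMax (q M t : ℕ) : Prop := ∀ j : ℕ, t * q ^ j % M ≤ t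

theorem isCosetMax_iff_sub_le {q M t : ℕ} (ht : 0 < t) (htM : t < M) (hc : Nat.Coprime M q) :
    IsCosetMax q M t ↔ ∀ j : ℕ, M - t ≤ (M - t) * q ^ j % M := by
  have hd (j : ℕ) : M ∣ t * q ^ j + (M - t) * q ^ j := by
    rw [← add_mul, show t + (M - t) = M by omega]; exact dvd_mul_right _ _
  have hpos {s : ℕ} (hs : 0 < s) (hsM : s < M) (j : ℕ) : 0 < s * q ^ j % M := by
    rw [Nat.pos_iff_ne_zero]
    intro h
    have h1 := (hc.pow_right j).dvd_of_dvd_mul_right (Nat.dvd_of_mod_eq_zero h)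
    exact absurd (Nat.le_of_dvd hs h1) (by omega)
  refine forall_congr' fun j => ?_
  have h1 := mod_eq_sub_mod (hd j) (by omega) (hpos ht htM j)
  have h2 := Nat.mod_lt (t * q ^ j) (show 0 < M by omega)
  omega

/-- If `t < 2 * q ^ (m - 1)` is maximal in its coset, then every nonzero tail of its base `q`
expansion has leading digit `1`, and rotating that digit to the top gives a lower bound on `t`. -/
theorem IsCosetMax.exists_tail_eq {q k M t U n B : ℕ} (hq : 3 ≤ q) (hM : M + 1 = q ^ (3 * k + 1))
    (hmax : IsCosetMax q M t) (ht2 : t < 2 * q ^ (3 * k)) (htM : t < M)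
    (ht : t = U * q ^ n + B) (hB : B < q ^ n) (hB0 : 0 < B) (hn : n ≤ 3 * k + 1) :
    ∃ c V, c < n ∧ V < q ^ c ∧ B = q ^ c + V ∧
      q ^ (3 * k) + V * q ^ (3 * k - c) + U * q ^ (n - 1 - c) ≤ t := by
  obtain ⟨c, hc⟩ : ∃ c, c = Nat.log q B := ⟨_, rfl⟩
  have hq0 : 0 < q := by omega
  have hcB : q ^ c ≤ B := hc ▸ Nat.pow_log_le_self q (by omega)
  have hBc : B < q ^ (c + 1) := hc ▸ Nat.lt_pow_succ_log_self (by omega) B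
  have hcn : c < n := (Nat.pow_lt_pow_iff_right (by omega)).1 (hcB.trans_lt hB)
  have hcpos : 0 < q ^ c := by positivity
  obtain ⟨e, he⟩ : ∃ e, e = B / q ^ c := ⟨_, rfl⟩
  obtain ⟨V, hVd⟩ : ∃ V, V = B % q ^ c := ⟨_, rfl⟩
  have hV : V < q ^ c := hVd ▸ Nat.mod_lt _ hcpos
  have hBe : B = q ^ c * e + V := by rw [he, hVd, Nat.div_add_mod]
  have he1 : 1 ≤ e := by rw [he]; exact (Nat.one_le_div_iff hcpos).2 hcB
  have heq : e < q := by
    rw [he]; apply Nat.div_lt_of_lt_mul; rwa [pow_succ] at hBc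
  obtain ⟨d, hd⟩ : ∃ d, 3 * k = c + d := ⟨3 * k - c, by omega⟩
  obtain ⟨f, hf⟩ : ∃ f, n = c + 1 + f := ⟨n - 1 - c, by omega⟩
  have hd' : 3 * k - c = d := by omega
  have hf' : n - 1 - c = f := by omega
  have hdpos : 0 < q ^ d := by positivity
  have hU : U * q ^ f < q ^ d := by
    have h1 : U * q ^ f * q ^ (c + 1) < q ^ d * q ^ (c + 1) := by
      rw [← pow_add, show d + (c + 1) = 3 * k + 1 by omega, ← hM, mul_assoc, ← pow_add,
        show f + (c + 1) = n by omega]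
      omega
    exact lt_of_mul_lt_mul_right h1 (Nat.zero_le _)
  have hrot : t * q ^ d = M * (U * q ^ f) + (e * q ^ (3 * k) + V * q ^ d + U * q ^ f) := by
    have : U * q ^ n * q ^ d = U * q ^ f * (M + 1) := by
      rw [hM, hf, hd]; ring
    rw [ht, hBe, add_mul, this, hd, pow_add]; ring
  have hVd : V * q ^ d + q ^ d ≤ q ^ (3 * k) := by
    have h1 : (V + 1) * q ^ d ≤ q ^ c * q ^ d := Nat.mul_le_mul_right _ hV
    rw [hd, pow_add]; linarith
  have heM : e * q ^ (3 * k) + q ^ (3 * k) ≤ M + 1 := by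
    have h1 : (e + 1) * q ^ (3 * k) ≤ q * q ^ (3 * k) := Nat.mul_le_mul_right _ heq
    rw [hM, pow_succ]; linarith
  have hlt : e * q ^ (3 * k) + V * q ^ d + U * q ^ f < M := by
    refine lt_of_le_of_ne (by omega) fun h => ?_
    have hdvd : M ∣ t * q ^ d := by
      rw [hrot, h]; exact ⟨U * q ^ f + 1, by ring⟩
    have hco : Nat.Coprime M q := coprime_of_add_one_eq_pow (by omega) hM
    exact absurd (Nat.le_of_dvd (by omega) ((hco.pow_right d).dvd_of_dvd_mul_right hdvd)) (by omega)
  have hle := hmax d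
  rw [hrot, Nat.mul_add_mod, Nat.mod_eq_of_lt hlt] at hle
  have he' : e = 1 := by
    by_contra hne
    have h1 : 2 * q ^ (3 * k) ≤ e * q ^ (3 * k) := Nat.mul_le_mul_right _ (by omega)
    omega
  subst he'
  refine ⟨c, V, hcn, hV, by omega, ?_⟩
  rw [hd', hf']
  omega

/-- The value `q ^ m - 1 - δ` for the `i`-th largest odd coset leader `δ`, where `m = 3 * k + 1`. -/
def leaderCompl (q k i : ℕ) : ℕ :=
  if i = 1 then q ^ (3 * k) else
    if i = 2 then q ^ (3 * k) + q ^ (2 * k) + q ^ k else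
      q ^ (3 * k) + q ^ (2 * k + 1) + q ^ (k + i - 4)

theorem IsCosetMax.pow_le {q k M t : ℕ} (hq : 3 ≤ q) (hM : M + 1 = q ^ (3 * k + 1))
    (hmax : IsCosetMax q M t) (ht0 : 0 < t) (htM : t < M) : q ^ (3 * k) ≤ t := by
  by_contra! h
  obtain ⟨c, hc⟩ : ∃ c, c = Nat.log q t := ⟨_, rfl⟩
  have h1 : q ^ c ≤ t := hc ▸ Nat.pow_log_le_self q (by omega)
  have hck : c < 3 * k := (Nat.pow_lt_pow_iff_right (by omega)).1 (h1.trans_lt h)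
  obtain ⟨c, V, hcn, hV, hB, hle⟩ := hmax.exists_tail_eq (U := 0) (n := 3 * k + 1) (B := t) hq hM
    (by omega) htM (by omega) (by omega) ht0 le_rfl
  omega

theorem even_sub_pow {q c B V : ℕ} (hq : Odd q) (h : B = q ^ c + V) : Even V ↔ ¬ Even B := by
  have : Odd (q ^ c) := hq.pow
  rw [h, Nat.even_add]
  simp [Nat.not_even_iff_odd.2 this]

theorem exists_eq_leaderCompl {q k M t : ℕ} (hq : 3 ≤ q) (hqo : Odd q) (hk : 2 ≤ k)
    (hM : M + 1 = q ^ (3 * k + 1)) (hmax : IsCosetMax q M t) (hodd : Odd t) (htM : t < M)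
    (hle : t ≤ leaderCompl q k 6) : ∃ i, 1 ≤ i ∧ i ≤ 6 ∧ t = leaderCompl q k i := by
  have ht0 : 0 < t := hodd.pos
  have hq1 : 1 < q := by omega
  have hlow := hmax.pow_le hq hM ht0 htM
  rcases hle.eq_or_lt with h6 | hlt
  · exact ⟨6, by omega, le_rfl, h6⟩
  have h6 : leaderCompl q k 6 = q ^ (3 * k) + q ^ (2 * k + 1) + q ^ (k + 2) := by
    simp [leaderCompl]
  rw [h6] at hlt
  obtain ⟨r, hr⟩ : ∃ r, t = q ^ (3 * k) + r := ⟨t - q ^ (3 * k), by omega⟩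
  have hr6 : r < q ^ (2 * k + 1) + q ^ (k + 2) := by omega
  have hr3 : r < q ^ (3 * k) :=
    (hr6.trans (pow_add_pow_lt hq (by omega) (by omega : k + 2 < 2 * k + 2))).trans_le
      (Nat.pow_le_pow_right (by omega) (by omega))
  have ht2 : t < 2 * q ^ (3 * k) := by omega
  rcases Nat.eq_zero_or_pos r with rfl | hr0
  · exact ⟨1, le_rfl, by omega, by simpa [leaderCompl] using hr⟩
  obtain ⟨a, r₁, ha, hr₁, rfl, hrot₁⟩ := hmax.exists_tail_eq (U := 1) (n := 3 * k) (B := r) hq hM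
    ht2 htM (by omega) hr3 hr0 (by omega)
  have hr₁odd : Odd r₁ := by
    rw [← Nat.not_even_iff_odd, even_sub_pow hqo rfl, even_sub_pow hqo hr, not_not,
      Nat.not_even_iff_odd]
    exact hodd
  have hexp {x : ℕ} (h : q ^ x ≤ q ^ a + r₁) : x ≤ a := by
    have h1 : q ^ a * 3 ≤ q ^ a * q := Nat.mul_le_mul_left _ hq
    have : q ^ x < q ^ (a + 1) := by rw [pow_succ]; omega
    have := (Nat.pow_lt_pow_iff_right hq1).1 this
    omega
  have hak : a ≤ 2 * k + 1 := by
    have := (Nat.pow_lt_pow_iff_right hq1).1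
      ((le_self_add.trans_lt hr6).trans (pow_add_pow_lt hq (by omega) (by omega : k + 2 < 2 * k + 2)))
    omega
  obtain ⟨b, r₂, hb, hr₂, rfl, hrot₂⟩ := hmax.exists_tail_eq (U := q ^ (3 * k - a) + 1) (n := a)
    (B := r₁) hq hM ht2 htM
    (by rw [hr, add_mul, ← pow_add, show 3 * k - a + a = 3 * k by omega]; ring) hr₁ hr₁odd.pos
    (by omega)
  have hbk (h : a = 2 * k + 1) : b < k + 2 := by
    subst h
    exact (Nat.pow_lt_pow_iff_right hq1).1 (by omega)
  have hba : 3 * k + b ≤ 2 * a := by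
    have h1 : q ^ b * q ^ (3 * k - a) ≤ (q ^ b + r₂) * q ^ (3 * k - a) :=
      Nat.mul_le_mul_right _ le_self_add
    have := hexp (x := b + (3 * k - a)) (by rw [pow_add]; omega)
    omega
  have hUb : q ^ (3 * k - 1 - b) + q ^ (a - 1 - b) = (q ^ (3 * k - a) + 1) * q ^ (a - 1 - b) := by
    rw [add_mul, ← pow_add, show 3 * k - a + (a - 1 - b) = 3 * k - 1 - b by omega, one_mul]
  rw [← hUb] at hrot₂
  rcases Nat.eq_zero_or_pos r₂ with rfl | hr₂pos
  · have hb' : 3 * k - 1 - b ≤ a := hexp (by omega)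
    by_cases h : a = 2 * k + 1
    · have hbk := hbk h
      have hb2 : b ≠ k - 2 := by
        rintro rfl
        rw [show 3 * k - 1 - (k - 2) = a by omega, show a - 1 - (k - 2) = k + 2 by omega] at hrot₂
        have : q ^ (k - 2) < q ^ (k + 2) := (Nat.pow_lt_pow_iff_right hq1).2 (by omega)
        omega
      refine ⟨b + 4 - k, by omega, by omega, ?_⟩
      rw [leaderCompl, if_neg (by omega), if_neg (by omega),
        show k + (b + 4 - k) - 4 = b by omega, hr, h]
      ring
    · obtain rfl : a = 2 * k := by omega
      have hb2 : b ≠ k - 1 := by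
        rintro rfl
        rw [show 3 * k - 1 - (k - 1) = 2 * k by omega, show 2 * k - 1 - (k - 1) = k by omega]
          at hrot₂
        have : q ^ (k - 1) < q ^ k := (Nat.pow_lt_pow_iff_right hq1).2 (by omega)
        omega
      obtain rfl : b = k := by omega
      refine ⟨2, by omega, by omega, ?_⟩
      simp [leaderCompl, hr, add_assoc]
  · exfalso
    obtain ⟨U, hU⟩ : ∃ U, U = q ^ (3 * k - b) + q ^ (a - b) + 1 := ⟨_, rfl⟩
    have htU : t = U * q ^ b + r₂ := by
      rw [hr, hU, add_mul, add_mul, ← pow_add, ← pow_add, show 3 * k - b + b = 3 * k by omega,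
        show a - b + b = a by omega]
      ring
    have hr₂even : Even r₂ := by
      rw [even_sub_pow hqo rfl, Nat.not_even_iff_odd]; exact hr₁odd
    obtain ⟨c, r₃, hc, hr₃, rfl, hrot₃⟩ := hmax.exists_tail_eq (U := U) (n := b)
      hq hM ht2 htM htU hr₂ hr₂pos (by omega)
    have hr₃odd : Odd r₃ := by
      rw [← Nat.not_even_iff_odd, even_sub_pow hqo rfl, not_not]; exact hr₂even
    obtain ⟨W, hW⟩ : ∃ W, W = U * q ^ (b - c) + 1 := ⟨_, rfl⟩
    have htW : t = W * q ^ c + r₃ := by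
      rw [htU, hW, add_mul, mul_assoc, ← pow_add, show b - c + c = b by omega]
      ring
    obtain ⟨d, r₄, hd, hr₄, rfl, hrot₄⟩ := hmax.exists_tail_eq (U := W) (n := c)
      hq hM ht2 htM htW hr₃ hr₃odd.pos (by omega)
    have hcb : 3 * k + c ≤ a + b := by
      have h1 : q ^ c * q ^ (3 * k - b) ≤ (q ^ c + (q ^ d + r₄)) * q ^ (3 * k - b) :=
        Nat.mul_le_mul_right _ le_self_add
      have := hexp (x := c + (3 * k - b)) (by rw [pow_add]; omega)
      omega
    have hdc : 3 * k + d ≤ a + c := by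
      have h1 : q ^ d * q ^ (3 * k - c) ≤ (q ^ d + r₄) * q ^ (3 * k - c) :=
        Nat.mul_le_mul_right _ le_self_add
      have := hexp (x := d + (3 * k - c)) (by rw [pow_add]; omega)
      omega
    have hWd : q ^ (3 * k - 1 - d) + q ^ (a - 1 - d) ≤ W * q ^ (c - 1 - d) := by
      have h1 : q ^ (3 * k - 1 - d) + q ^ (a - 1 - d) =
          (q ^ (3 * k - b) + q ^ (a - b)) * q ^ (b - c) * q ^ (c - 1 - d) := by
        rw [mul_assoc, ← pow_add, add_mul, ← pow_add, ← pow_add,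
          show 3 * k - b + (b - c + (c - 1 - d)) = 3 * k - 1 - d by omega,
          show a - b + (b - c + (c - 1 - d)) = a - 1 - d by omega]
      rw [h1]
      refine Nat.mul_le_mul_right _ ?_
      rw [hW, hU, add_mul _ 1]
      omega
    have hda : 3 * k - 1 - d ≤ a := hexp (by omega)
    obtain rfl : a = 2 * k + 1 := by omega
    have hbk := hbk rfl
    obtain rfl : k = 2 := by omega
    by_cases hd0 : d = 0
    · subst hd0
      norm_num at *
      omega
    · obtain rfl : d = 1 := by omega
      obtain rfl : c = 2 := by omega
      obtain rfl : b = 3 := by omega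
      have h1 : (q ^ 2 + (q ^ 1 + r₄)) * q ^ (3 * 2 - 3) = q ^ 5 + q ^ 4 + r₄ * q ^ 3 := by
        norm_num; ring
      norm_num at *
      omega

theorem leaderCompl_lt_succ {q k i : ℕ} (hq : 3 ≤ q) (hk : 2 ≤ k) (hi : 1 ≤ i) :
    leaderCompl q k i < leaderCompl q k (i + 1) := by
  have hp (x : ℕ) : 0 < q ^ x := by positivity
  unfold leaderCompl
  by_cases h1 : i = 1
  · subst h1
    have := hp (2 * k)
    simp
    omega
  by_cases h2 : i = 2
  · subst h2
    have := pow_add_pow_lt hq (show 2 * k < 2 * k + 1 by omega) (show k < 2 * k + 1 by omega)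
    simp
    omega
  · rw [if_neg h1, if_neg h2, if_neg (by omega), if_neg (by omega)]
    by_cases h3 : k + i - 4 < k + (i + 1) - 4
    · have : q ^ (k + i - 4) < q ^ (k + (i + 1) - 4) := Nat.pow_lt_pow_right (by omega) h3
      omega
    · omega

theorem leaderCompl_strictMonoOn {q k : ℕ} (hq : 3 ≤ q) (hk : 2 ≤ k) :
    StrictMonoOn (leaderCompl q k) (Set.Ici 1) := by
  intro i hi j _ hij
  obtain ⟨d, rfl⟩ := Nat.exists_eq_add_of_lt hij
  clear hij
  induction d with
  | zero => exact leaderCompl_lt_succ hq hk hi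
  | succ d ih =>
    exact (ih (by simp at *)).trans (leaderCompl_lt_succ hq hk (by simp at hi; omega))

theorem leaderCompl_lt {q k i M : ℕ} (hq : 3 ≤ q) (hk : 2 ≤ k) (hM : M + 1 = q ^ (3 * k + 1))
    (hi1 : 1 ≤ i) (hi : i ≤ 6) : leaderCompl q k i < M := by
  refine ((leaderCompl_strictMonoOn hq hk).monotoneOn (Set.mem_Ici.2 hi1)
    (Set.mem_Ici.2 (by norm_num)) hi).trans_lt ?_
  have h1 := pow_add_pow_lt hq (show 2 * k + 1 < 2 * k + 2 by omega)
    (show k + 2 < 2 * k + 2 by omega)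
  have h2 : q ^ (2 * k + 2) ≤ q ^ (3 * k) := Nat.pow_le_pow_right (by omega) (by omega)
  have h3 : q ^ (3 * k) * 3 ≤ q ^ (3 * k) * q := Nat.mul_le_mul_left _ hq
  have h4 : 0 < q ^ (3 * k) := by positivity
  rw [pow_succ] at hM
  simp [leaderCompl]
  omega

theorem exists_pow_add_modEq {q m M e l : ℕ} (hM : M + 1 = q ^ m) (he : e < m) (hl : l < m) :
    ∃ x, (x = e + l ∨ x + m = e + l) ∧ x < m ∧ q ^ e * q ^ l ≡ q ^ x [MOD M] := by
  refine ⟨(e + l) % m, ?_, Nat.mod_lt _ (by omega), ?_⟩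
  · rcases lt_or_ge (e + l) m with h | h
    · exact Or.inl (Nat.mod_eq_of_lt h)
    · right
      rw [Nat.mod_eq_sub_mod h, Nat.mod_eq_of_lt (by omega)]
      omega
  · rw [← pow_add]; exact pow_modEq_pow_mod hM _

theorem sum_pow_mul_pow_mod_lt {q k a b M l : ℕ} (hq : 3 ≤ q) (hM : M + 1 = q ^ (3 * k + 1))
    (hb : b < a) (ha : a < 3 * k)
    (hla : q ^ (3 * k - 1 - a) + q ^ (b + (3 * k - a)) < q ^ a + q ^ b)
    (hlb : q ^ (3 * k - 1 - b) + q ^ (a - 1 - b) < q ^ a + q ^ b)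
    (hl0 : 0 < l) (hl : l < 3 * k + 1) :
    (q ^ (3 * k) + q ^ a + q ^ b) * q ^ l % M < q ^ (3 * k) + q ^ a + q ^ b := by
  obtain ⟨x, hx, hxm, hx'⟩ := exists_pow_add_modEq hM (show 3 * k < 3 * k + 1 by omega) hl
  obtain ⟨y, hy, hym, hy'⟩ := exists_pow_add_modEq hM (show a < 3 * k + 1 by omega) hl
  obtain ⟨z, hz, hzm, hz'⟩ := exists_pow_add_modEq hM (show b < 3 * k + 1 by omega) hl
  have h : (q ^ (3 * k) + q ^ a + q ^ b) * q ^ l % M = (q ^ x + q ^ y + q ^ z) % M := by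
    rw [add_mul, add_mul]
    exact (hx'.add hy').add hz'
  rw [h]
  refine (Nat.mod_le _ _).trans_lt ?_
  by_cases h1 : l = 3 * k - a
  · obtain rfl : x = 3 * k - 1 - a := by omega
    obtain rfl : y = 3 * k := by omega
    obtain rfl : z = b + (3 * k - a) := by omega
    omega
  by_cases h2 : l = 3 * k - b
  · obtain rfl : x = 3 * k - 1 - b := by omega
    obtain rfl : y = a - 1 - b := by omega
    obtain rfl : z = 3 * k := by omega
    omega
  have := pow_add_pow_add_pow_le hq (show x < 3 * k by omega) (show y < 3 * k by omega)
    (show z < 3 * k by omega)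
  have : 0 < q ^ a := by positivity
  omega

theorem leaderCompl_mul_pow_mod_lt {q k i M l : ℕ} (hq : 3 ≤ q) (hk : 2 ≤ k)
    (hM : M + 1 = q ^ (3 * k + 1)) (hi1 : 1 ≤ i) (hi : i ≤ 6) (hl0 : 0 < l)
    (hl : l < 3 * k + 1) : leaderCompl q k i * q ^ l % M < leaderCompl q k i := by
  have of_lt {x y a b : ℕ} (hx : x < a) (hy : y < a) : q ^ x + q ^ y < q ^ a + q ^ b :=
    (pow_add_pow_lt hq hx hy).trans_le le_self_add
  unfold leaderCompl
  by_cases h1 : i = 1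
  · rw [if_pos h1]
    obtain ⟨x, hx, hxm, hx'⟩ := exists_pow_add_modEq hM (show 3 * k < 3 * k + 1 by omega) hl
    rw [hx']
    exact (Nat.mod_le _ _).trans_lt (Nat.pow_lt_pow_right (by omega) (by omega))
  rw [if_neg h1]
  by_cases h2 : i = 2
  · rw [if_pos h2]
    refine sum_pow_mul_pow_mod_lt hq hM (by omega) (by omega) ?_ (of_lt (by omega) (by omega))
      hl0 hl
    rw [show k + (3 * k - 2 * k) = 2 * k by omega, add_comm (q ^ (2 * k))]
    exact Nat.add_lt_add_right (Nat.pow_lt_pow_right (by omega) (by omega)) _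
  rw [if_neg h2]
  refine sum_pow_mul_pow_mod_lt hq hM (by omega) (by omega) ?_ (of_lt (by omega) (by omega))
    hl0 hl
  by_cases h6 : i = 6
  · subst h6
    rw [show k + 6 - 4 + (3 * k - (2 * k + 1)) = 2 * k + 1 by omega, add_comm (q ^ (2 * k + 1))]
    exact Nat.add_lt_add_right (Nat.pow_lt_pow_right (by omega) (by omega)) _
  · exact of_lt (by omega) (by omega)

theorem isCosetMax_of_lt {q m M t : ℕ} (hm : 0 < m) (hM : M + 1 = q ^ m)
    (h : ∀ l, 0 < l → l < m → t * q ^ l % M < t) : IsCosetMax q M t := by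
  intro j
  have hj : t * q ^ j % M = t * q ^ (j % m) % M := (pow_modEq_pow_mod hM j).mul_left t
  rw [hj]
  rcases Nat.eq_zero_or_pos (j % m) with h0 | h0
  · rw [h0]; simpa using Nat.mod_le t M
  · exact (h _ h0 (Nat.mod_lt _ hm)).le

theorem ncard_qCoset_sub {q m M t : ℕ} (hm : 0 < m) (hM : M + 1 = q ^ m) (htM : t < M)
    (h : ∀ l, 0 < l → l < m → t * q ^ l % M < t) : (qCoset q M (M - t)).ncard = m := by
  have hqm : (q : ZMod M) ^ m = 1 := by
    have := congrArg (Nat.cast : ℕ → ZMod M) hM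
    push_cast at this
    simpa using this.symm
  have himg : qCoset q M (M - t) =
      (fun j : ℕ => ((M - t : ℕ) : ZMod M) * (q : ZMod M) ^ j) '' (Finset.range m : Set ℕ) := by
    ext x
    constructor
    · rintro ⟨j, rfl⟩
      refine ⟨j % m, by simpa using Nat.mod_lt j hm, ?_⟩
      conv_rhs => rw [← Nat.div_add_mod j m]
      simp [pow_add, pow_mul, hqm]
    · rintro ⟨j, -, rfl⟩
      exact ⟨j, rfl⟩
  have hne : ∀ i j : ℕ, i < j → j < m →
      ((M - t : ℕ) : ZMod M) * (q : ZMod M) ^ i ≠ ((M - t : ℕ) : ZMod M) * (q : ZMod M) ^ j := by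
    intro i j hij hj he
    have h1 : (t : ZMod M) = t * (q : ZMod M) ^ (j - i) := by
      rw [Nat.cast_sub htM.le, CharP.cast_eq_zero, zero_sub, neg_mul, neg_mul, neg_inj] at he
      have h2 := congrArg (· * (q : ZMod M) ^ (m - i)) he
      simp only [mul_assoc, ← pow_add] at h2
      rwa [show i + (m - i) = m by omega, show j + (m - i) = j - i + m by omega, pow_add, hqm,
        mul_one, mul_one] at h2
    have h2 : ((t : ℕ) : ZMod M) = ((t * q ^ (j - i) : ℕ) : ZMod M) := by push_cast; exact h1
    have h3 : t % M = t * q ^ (j - i) % M := (ZMod.natCast_eq_natCast_iff' _ _ _).1 h2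
    have h4 := h (j - i) (by omega) (by omega)
    rw [← h3, Nat.mod_eq_of_lt htM] at h4
    exact lt_irrefl _ h4
  rw [himg, Set.InjOn.ncard_image, Set.ncard_coe_finset, Finset.card_range]
  intro i hi j hj he
  simp only [Finset.coe_range, Set.mem_Iio] at hi hj
  rcases Nat.lt_trichotomy i j with hij | hij | hij
  · exact absurd he (hne i j hij hj)
  · exact hij
  · exact absurd he.symm (hne j i hij hi)

theorem mem_oddLeaders {q N s : ℕ} :
    s ∈ oddLeaders q N ↔ s < N ∧ Odd s ∧ ∀ j : ℕ, s ≤ s * q ^ j % N := by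
  simp [oddLeaders]

theorem odd_leaderCompl {q k i : ℕ} (hq : Odd q) : Odd (leaderCompl q k i) := by
  have h (x : ℕ) : Odd (q ^ x) := hq.pow
  unfold leaderCompl
  split_ifs
  · exact h _
  · exact ((h _).add_odd (h _)).add_odd (h _)
  · exact ((h _).add_odd (h _)).add_odd (h _)

theorem isIthLargest_sub_leaderCompl {q k i M : ℕ} (hq : 3 ≤ q) (hqo : Odd q) (hk : 2 ≤ k)
    (hM : M + 1 = q ^ (3 * k + 1)) (hi1 : 1 ≤ i) (hi : i ≤ 6) :
    IsIthLargest (oddLeaders q M) i (M - leaderCompl q k i) := by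
  have hco : Nat.Coprime M q := coprime_of_add_one_eq_pow (by omega) hM
  have hMe : Even M := by
    have : Odd (M + 1) := hM ▸ hqo.pow
    rw [Nat.odd_add_one, Nat.not_odd_iff_even] at this
    exact this
  have hlt {j : ℕ} (h1 : 1 ≤ j) (h6 : j ≤ 6) := leaderCompl_lt hq hk hM h1 h6
  have hmono := leaderCompl_strictMonoOn hq hk
  have hodd {t : ℕ} (htM : t < M) : Odd (M - t) ↔ Odd t := by
    rw [Nat.odd_sub htM.le]
    simp [Nat.not_odd_iff_even.2 hMe]
  have hmem {j : ℕ} (h1 : 1 ≤ j) (h6 : j ≤ 6) : M - leaderCompl q k j ∈ oddLeaders q M := by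
    have ho : Odd (leaderCompl q k j) := odd_leaderCompl hqo
    have hpos := ho.pos
    have hl := hlt h1 h6
    refine mem_oddLeaders.2 ⟨by omega, (hodd hl).2 ho,
      (isCosetMax_iff_sub_le hpos hl hco).1 (isCosetMax_of_lt (by omega) hM ?_)⟩
    exact fun l h0 hl => leaderCompl_mul_pow_mod_lt hq hk hM h1 h6 h0 hl
  refine ⟨hmem hi1 hi, ?_⟩
  have himg : (oddLeaders q M).filter (fun y => M - leaderCompl q k i ≤ y) =
      (Finset.Icc 1 i).image fun j => M - leaderCompl q k j := by
    ext y
    simp only [Finset.mem_filter, Finset.mem_image, Finset.mem_Icc]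
    constructor
    · rintro ⟨hy, hle⟩
      obtain ⟨hyM, hyo, hyl⟩ := mem_oddLeaders.1 hy
      have hy0 := hyo.pos
      have hyy : M - (M - y) = y := by omega
      have hto : Odd (M - y) := by rw [hodd hyM]; exact hyo
      have hmax : IsCosetMax q M (M - y) := by
        rw [isCosetMax_iff_sub_le (by omega) (by omega) hco, hyy]; exact hyl
      have hti : M - y ≤ leaderCompl q k i := by have := hlt hi1 hi; omega
      obtain ⟨j, hj1, hj6, hj⟩ := exists_eq_leaderCompl hq hqo hk hM hmax hto (by omega)
        (hti.trans (hmono.monotoneOn (Set.mem_Ici.2 hi1) (Set.mem_Ici.2 (by norm_num)) hi))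
      refine ⟨j, ⟨hj1, ?_⟩, by omega⟩
      rw [hj] at hti
      exact (hmono.le_iff_le (Set.mem_Ici.2 hj1) (Set.mem_Ici.2 hi1)).1 hti
    · rintro ⟨j, ⟨hj1, hji⟩, rfl⟩
      exact ⟨hmem hj1 (hji.trans hi), Nat.sub_le_sub_left
        (hmono.monotoneOn (Set.mem_Ici.2 hj1) (Set.mem_Ici.2 hi1) hji) _⟩
  rw [himg, Finset.card_image_of_injOn, Nat.card_Icc, Nat.add_sub_cancel]
  intro a ha b hb hab
  simp only [Finset.coe_Icc, Set.mem_Icc] at ha hb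
  have h1 := hlt ha.1 (ha.2.trans hi)
  have h2 := hlt hb.1 (hb.2.trans hi)
  exact hmono.injOn (Set.mem_Ici.2 ha.1) (Set.mem_Ici.2 hb.1) (by simp only at hab; omega)

theorem stmt_9 (q m n : ℕ)
    (hq : ∃ p e : ℕ, p.Prime ∧ Odd p ∧ 0 < e ∧ q = p ^ e)
    (hq3 : 3 ≤ q) (hm : 7 ≤ m) (hm3 : m % 3 = 1) (hn : 2 * n = q ^ m - 1) :
    ∀ i, 2 ≤ i → i ≤ 6 →
      (IsIthLargest (oddLeaders q (2 * n)) i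
        (q ^ m - q ^ (m - 1) -
          q ^ (if i = 2 then (2 * m + 1) / 3 - 1 else (2 * m + 1) / 3) -
          q ^ (if i = 2 then (m - 1) / 3 else (m - 1) / 3 + i - 4) - 1) ∧
      (4 ≤ i →
        (qCoset q (2 * n)
          (q ^ m - q ^ (m - 1) -
          q ^ (if i = 2 then (2 * m + 1) / 3 - 1 else (2 * m + 1) / 3) -
          q ^ (if i = 2 then (m - 1) / 3 else (m - 1) / 3 + i - 4) - 1)).ncard = m)) := by
  obtain ⟨k, rfl⟩ : ∃ k, m = 3 * k + 1 := ⟨m / 3, by omega⟩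
  have hk : 2 ≤ k := by omega
  have hqo : Odd q := by
    obtain ⟨p, e, -, hp, -, rfl⟩ := hq
    exact hp.pow
  have hM : 2 * n + 1 = q ^ (3 * k + 1) := by
    have : 0 < q ^ (3 * k + 1) := by positivity
    omega
  intro i hi2 hi6
  have heq : q ^ (3 * k + 1) - q ^ (3 * k + 1 - 1) -
      q ^ (if i = 2 then (2 * (3 * k + 1) + 1) / 3 - 1 else (2 * (3 * k + 1) + 1) / 3) -
      q ^ (if i = 2 then (3 * k + 1 - 1) / 3 else (3 * k + 1 - 1) / 3 + i - 4) - 1 =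
      2 * n - leaderCompl q k i := by
    rw [show (2 * (3 * k + 1) + 1) / 3 = 2 * k + 1 by omega,
      show 3 * k + 1 - 1 = 3 * k by omega, show 3 * k / 3 = k by omega,
      show 2 * k + 1 - 1 = 2 * k by omega, ← hM, leaderCompl, if_neg (show i ≠ 1 by omega)]
    split_ifs <;> omega
  rw [heq]
  refine ⟨isIthLargest_sub_leaderCompl hq3 hqo hk hM (by omega) hi6, fun _ => ?_⟩
  exact ncard_qCoset_sub (by omega) hM (leaderCompl_lt hq3 hk hM (by omega) hi6)
    fun l h0 hl => leaderCompl_mul_pow_mod_lt hq3 hk hM (by omega) hi6 h0 hl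
end

section
/- Let q ≥ 3 be a power of an odd prime, let m ≥ 3, n = (q^m−1)/2, and δ_1′ = q^m − q^{m−1} − 1 (the largest odd q-cyclotomic coset leader modulo 2n). Let C′ be the negacyclic code of length n over F_q with parity-check polynomial lcm(M_1(x), M_{δ_1′}(x)), i.e. the ideal of F_q[x]/(x^n+1) generated by (x^n+1)/(M_1(x)·M_{δ_1′}(x)). Then C′ has dimension 2m and minimum Hamming distance at least ((q−2)q^{m−1}−1)/2, and its dual code C′^⊥ has dimension n − 2m and minimum Hamming distance d with 3 ≤ d ≤ 5. -/
open Finset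

section
variable {F E : Type*} [Field F] [Field E] [Algebra F E] {n : ℕ}

lemma evalAt_apply (x : E) (c : Fin n → F) :
    evalAt F n x c = ∑ j : Fin n, algebraMap F E (c j) * x ^ (j : ℕ) := by
  simp [evalAt, Algebra.smul_def]

lemma hWt_eq_card [DecidableEq F] (c : Fin n → F) :
    hWt c = (univ.filter fun j => c j ≠ 0).card := by
  unfold hWt hammingNorm
  congr!

/-- A word vanishing at as many consecutive terms of a geometric progression as its weight is
zero (the argument behind the BCH bound). -/
lemma eq_zero_of_evalAt_geometric_eq_zero {x y : E} (hx : x ≠ 0)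
    (hy : Function.Injective fun j : Fin n => y ^ (j : ℕ)) (c : Fin n → F)
    (h : ∀ t < hWt c, evalAt F n (x * y ^ t) c = 0) : c = 0 := by
  classical
  by_contra hc
  obtain ⟨i, hi⟩ := Function.ne_iff.mp hc
  simp only [Pi.zero_apply] at hi
  set S := univ.filter fun j => c j ≠ 0 with hS
  have hiS : i ∈ S := by simp [hS, hi]
  set P : Polynomial E := ∏ j ∈ S.erase i, (Polynomial.X - Polynomial.C (y ^ (j : ℕ))) with hP
  have hdeg : P.natDegree < hWt c := by
    rw [hP, Polynomial.natDegree_prod_of_monic _ _ fun j _ => Polynomial.monic_X_sub_C _,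
      hWt_eq_card, ← hS]
    simpa only [Polynomial.natDegree_X_sub_C, sum_const, smul_eq_mul, mul_one] using
      card_erase_lt_of_mem hiS
  have h1 : ∑ j : Fin n, algebraMap F E (c j) * x ^ (j : ℕ) * P.eval (y ^ (j : ℕ)) = 0 := by
    have : ∀ j : Fin n, algebraMap F E (c j) * x ^ (j : ℕ) * P.eval (y ^ (j : ℕ)) =
        ∑ t ∈ range (hWt c), P.coeff t * (algebraMap F E (c j) * (x * y ^ t) ^ (j : ℕ)) := by
      intro j
      rw [Polynomial.eval_eq_sum_range' hdeg, mul_sum]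
      refine sum_congr rfl fun t _ => ?_
      ring
    simp_rw [this]
    rw [sum_comm]
    refine sum_eq_zero fun t ht => ?_
    rw [← mul_sum, ← evalAt_apply, h t (mem_range.mp ht), mul_zero]
  rw [sum_eq_single i] at h1
  · have h2 : P.eval (y ^ (i : ℕ)) ≠ 0 := by
      rw [hP, Polynomial.eval_prod, prod_ne_zero_iff]
      intro j hj
      simp only [Polynomial.eval_sub, Polynomial.eval_X, Polynomial.eval_C]
      exact sub_ne_zero.mpr fun e => (mem_erase.mp hj).1 (hy e).symm
    simp [hi, hx, h2] at h1
  · intro j _ hji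
    by_cases hj : c j = 0
    · simp [hj]
    · have : P.eval (y ^ (j : ℕ)) = 0 := by
        rw [hP, Polynomial.eval_prod]
        exact prod_eq_zero (mem_erase.mpr ⟨hji, by simpa [hS] using hj⟩) (by simp)
      rw [this, mul_zero]
  · simp

lemma eq_zero_of_evalAt_eq_zero_of_pow_eq_neg_one {c : Fin n → F} {y : E}
    (hy : IsPrimitiveRoot y (2 * n)) (hn0 : 0 < n) (hn : y ^ n = -1)
    (hc : ∀ x : E, x ^ n = -1 → evalAt F n x c = 0) : c = 0 := by
  have hw : hWt c ≤ n := by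
    classical
    rw [hWt_eq_card]
    exact (card_filter_le _ _).trans (by simp)
  refine eq_zero_of_evalAt_geometric_eq_zero (hy.ne_zero (by omega)) (y := y ^ 2) ?_ c
    fun t _ => hc _ ?_
  · intro i j hij
    simp only [← pow_mul] at hij
    have := hy.pow_inj (by omega) (by omega) hij
    omega
  · rw [mul_pow, hn, ← pow_mul, ← pow_mul, show 2 * (t * n) = 2 * n * t by ring, pow_mul,
      hy.pow_eq_one, one_pow, mul_one]

lemma finrank_dualCode (C : Submodule F (Fin n → F)) :
    Module.finrank F (dualCode C) = n - Module.finrank F C := by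
  have h : dualCode C = C.dualAnnihilator.comap (dotProductEquiv F (Fin n) : (Fin n → F) →ₗ[F] _) := by
    ext y
    simp [dualCode, Submodule.mem_dualAnnihilator, dotProduct]
  have h2 := Subspace.finrank_add_finrank_dualAnnihilator_eq C
  rw [Module.finrank_fin_fun] at h2
  rw [h, Submodule.comap_equiv_eq_map_symm, LinearEquiv.finrank_map_eq]
  omega

end

section
variable (F : Type*) {E : Type*} [Field F] [Fintype F] [Field E] [Algebra F E] {n : ℕ}

/-- The elements fixed by the `m`-th power of the Frobenius. -/
def frobFixed (F E : Type*) [Field F] [Fintype F] [Field E] [Algebra F E] (m : ℕ) :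
    Submodule F E :=
  LinearMap.eqLocus (FiniteField.frobeniusAlgHom F E ^ m).toLinearMap LinearMap.id

lemma frobenius_pow_apply (m : ℕ) (x : E) :
    (FiniteField.frobeniusAlgHom F E ^ m) x = x ^ (Fintype.card F ^ m) := by
  simp [AlgHom.coe_pow, FiniteField.coe_frobeniusAlgHom, pow_iterate]

lemma mem_frobFixed {m : ℕ} {x : E} : x ∈ frobFixed F E m ↔ x ^ (Fintype.card F ^ m) = x := by
  simp [frobFixed, frobenius_pow_apply]

lemma evalAt_pow_card_pow (k : ℕ) (x : E) (c : Fin n → F) :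
    evalAt F n (x ^ (Fintype.card F ^ k)) c = evalAt F n x c ^ (Fintype.card F ^ k) := by
  rw [← frobenius_pow_apply F k x, ← frobenius_pow_apply F k]
  simp only [evalAt_apply, map_sum, map_mul, map_pow, AlgHom.commutes]

lemma exists_algebraMap_eq_of_pow_card_eq {x : E} (hx : x ^ Fintype.card F = x) :
    ∃ a : F, algebraMap F E a = x := by
  have h1 : (Polynomial.X ^ Fintype.card F - Polynomial.X : Polynomial F) =
      ∏ a : F, (Polynomial.X - Polynomial.C a) := by
    have hcard : 1 < Fintype.card F := Fintype.one_lt_card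
    have hd := FiniteField.X_pow_card_sub_X_natDegree_eq F hcard
    have hroots := FiniteField.roots_X_pow_card_sub_X F
    have hm : (Polynomial.X ^ Fintype.card F - Polynomial.X : Polynomial F).Monic :=
      Polynomial.monic_X_pow_sub (by simpa using hcard)
    have := Polynomial.prod_multiset_X_sub_C_of_monic_of_roots_card_eq hm (by
      rw [hroots, hd]; rfl)
    rw [hroots] at this
    exact this.symm
  have h2 := congrArg (Polynomial.aeval x) h1
  simp only [map_sub, map_pow, Polynomial.aeval_X, hx, sub_self, map_prod, Polynomial.aeval_C] at h2
  obtain ⟨a, -, ha⟩ := prod_eq_zero_iff.mp h2.symm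
  exact ⟨a, (sub_eq_zero.mp ha).symm⟩

lemma natCard_frobFixed {m : ℕ} {γ : E} (hγ : IsPrimitiveRoot γ (2 * n)) (hn0 : 0 < n)
    (hn : 2 * n + 1 = Fintype.card F ^ m) :
    Nat.card (frobFixed F E m) = Fintype.card F ^ m := by
  have hmem : ∀ o : Option (Fin (2 * n)), (o.elim 0 fun i => γ ^ (i : ℕ)) ∈ frobFixed F E m := by
    intro o
    rw [mem_frobFixed, ← hn]
    cases o with
    | none => simp
    | some i =>
      rw [Option.elim_some, pow_succ, ← pow_mul, mul_comm (i : ℕ), pow_mul, hγ.pow_eq_one]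
      simp
  have hbij : Function.Bijective
      fun o : Option (Fin (2 * n)) => (⟨_, hmem o⟩ : frobFixed F E m) := by
    have hγ0 : γ ≠ 0 := hγ.ne_zero (by omega)
    constructor
    · intro o o' h
      rw [Subtype.mk.injEq] at h
      cases o with
      | none => cases o' with
        | none => rfl
        | some j => exact absurd h.symm (pow_ne_zero _ hγ0)
      | some i => cases o' with
        | none => exact absurd h (pow_ne_zero _ hγ0)
        | some j => exact congrArg some (Fin.ext (hγ.pow_inj i.2 j.2 h))
    · rintro ⟨x, hx⟩
      by_cases hx0 : x = 0
      · exact ⟨none, Subtype.ext hx0.symm⟩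
      · have := (mem_frobFixed F).mp hx
        rw [← hn, pow_succ] at this
        have : NeZero (2 * n) := ⟨by omega⟩
        obtain ⟨i, hi, rfl⟩ := hγ.eq_pow_of_pow_eq_one (mul_right_cancel₀ hx0 (by simpa using! ‹_ = x›))
        exact ⟨some ⟨i, hi⟩, rfl⟩
  rw [← Nat.card_congr (Equiv.ofBijective _ hbij), ← hn]
  simp

lemma finrank_frobFixed {m : ℕ} {γ : E} (hγ : IsPrimitiveRoot γ (2 * n)) (hn0 : 0 < n)
    (hn : 2 * n + 1 = Fintype.card F ^ m) :
    Module.Finite F (frobFixed F E m) ∧ Module.finrank F (frobFixed F E m) = m := by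
  have hcard := natCard_frobFixed F hγ hn0 hn
  have : Finite (frobFixed F E m) := Nat.finite_of_card_ne_zero (by omega)
  have hfin : Module.Finite F (frobFixed F E m) := inferInstance
  refine ⟨hfin, ?_⟩
  rw [Module.natCard_eq_pow_finrank (K := F), Nat.card_eq_fintype_card] at hcard
  exact Nat.pow_right_injective Fintype.one_lt_card hcard

variable {F}

lemma sum_fin_pow_of_pow_eq_one {z : E} [DecidableEq E] (hz : z ^ n = 1) :
    ∑ j : Fin n, z ^ (j : ℕ) = if z = 1 then (n : E) else 0 := by
  rw [Fin.sum_univ_eq_sum_range fun j => z ^ j]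
  split_ifs with h
  · simp [h]
  · rw [geom_sum_eq h, hz, sub_self, zero_div]

lemma add_pow_card_pow (k : ℕ) (x y : E) :
    (x + y) ^ (Fintype.card F ^ k) = x ^ (Fintype.card F ^ k) + y ^ (Fintype.card F ^ k) := by
  simp only [← frobenius_pow_apply F k, map_add]

lemma sum_pow_card_pow (k : ℕ) {ι : Type*} (s : Finset ι) (f : ι → E) :
    (∑ i ∈ s, f i) ^ (Fintype.card F ^ k) = ∑ i ∈ s, f i ^ (Fintype.card F ^ k) := by
  simp only [← frobenius_pow_apply F k, map_sum]

/-- The word of length `n` whose entries are the traces of `a * γ⁻¹ ^ j + b * γ ^ j`. -/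
def IsTraceWord (m : ℕ) (γ a b : E) (c : Fin n → F) : Prop :=
  ∀ j : Fin n, algebraMap F E (c j) =
    ∑ k ∈ range m, (a * γ⁻¹ ^ (j : ℕ) + b * γ ^ (j : ℕ)) ^ (Fintype.card F ^ k)

lemma IsTraceWord.symm {m : ℕ} {γ a b : E} {c : Fin n → F} (hc : IsTraceWord m γ a b c) :
    IsTraceWord m γ⁻¹ b a c := by
  intro j
  rw [hc j, inv_inv]
  simp only [add_comm]

lemma exists_isTraceWord {m : ℕ} {γ a b : E} (hγ : γ ∈ frobFixed F E m)
    (ha : a ∈ frobFixed F E m) (hb : b ∈ frobFixed F E m) :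
    ∃ c : Fin n → F, IsTraceWord m γ a b c := by
  rw [mem_frobFixed] at hγ ha hb
  refine Classical.skolem.mp fun j => exists_algebraMap_eq_of_pow_card_eq F ?_
  set z := a * γ⁻¹ ^ (j : ℕ) + b * γ ^ (j : ℕ) with hz
  have hzm : z ^ (Fintype.card F ^ m) = z := by
    rw [hz, add_pow_card_pow, mul_pow, mul_pow, ha, hb, ← pow_mul, ← pow_mul, mul_comm (j : ℕ),
      pow_mul, pow_mul, inv_pow, hγ]
  have h1 := sum_pow_card_pow (F := F) 1 (range m) fun k => z ^ (Fintype.card F ^ k)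
  rw [pow_one] at h1
  rw [h1]
  have h2 := sum_range_succ' (fun k => z ^ (Fintype.card F ^ k)) m
  rw [sum_range_succ, hzm, pow_zero, pow_one] at h2
  simp only [← pow_mul, ← pow_succ]
  exact (add_right_cancel h2).symm

lemma IsTraceWord.evalAt_eq [DecidableEq E] {m : ℕ} {γ a b x : E} {c : Fin n → F}
    (hc : IsTraceWord m γ a b c) (hodd : Odd (Fintype.card F)) (hγ : γ ^ n = -1)
    (hx : x ^ n = -1) (hγ0 : γ ≠ 0) :
    evalAt F n x c = n * ∑ k ∈ range m, ((if x = γ ^ (Fintype.card F ^ k)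
      then a ^ (Fintype.card F ^ k) else 0) +
      (if x = γ⁻¹ ^ (Fintype.card F ^ k) then b ^ (Fintype.card F ^ k) else 0)) := by
  have key : ∀ y : E, y ≠ 0 → y ^ n = -1 → ∀ k : ℕ,
      ∑ j : Fin n, (x * y⁻¹ ^ (Fintype.card F ^ k)) ^ (j : ℕ) =
        if x = y ^ (Fintype.card F ^ k) then (n : E) else 0 := by
    intro y hy0 hy k
    rw [sum_fin_pow_of_pow_eq_one]
    · congr 1
      rw [inv_pow, mul_inv_eq_one₀ (pow_ne_zero _ hy0)]
    · rw [mul_pow, hx, ← pow_mul, mul_comm _ n, pow_mul, inv_pow, hy, inv_neg, inv_one,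
        (hodd.pow).neg_one_pow]
      norm_num
  have hγi : γ⁻¹ ^ n = -1 := by rw [inv_pow, hγ, inv_neg, inv_one]
  rw [evalAt_apply]
  simp_rw [hc _, add_pow_card_pow, sum_mul]
  rw [sum_comm, mul_sum]
  refine sum_congr rfl fun k _ => ?_
  have h1 := key γ hγ0 hγ k
  have h2 := key γ⁻¹ (inv_ne_zero hγ0) hγi k
  rw [inv_inv] at h2
  calc _ = a ^ (Fintype.card F ^ k) * ∑ j : Fin n, (x * γ⁻¹ ^ (Fintype.card F ^ k)) ^ (j : ℕ) +
        b ^ (Fintype.card F ^ k) * ∑ j : Fin n, (x * γ ^ (Fintype.card F ^ k)) ^ (j : ℕ) := by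
          rw [mul_sum, mul_sum, ← sum_add_distrib]
          refine sum_congr rfl fun j _ => ?_
          simp only [mul_pow, ← pow_mul, mul_comm (j : ℕ)]
          ring
    _ = _ := by
          rw [h1, h2]
          split_ifs <;> ring

lemma natCast_ne_zero_of_two_mul_add_one {m : ℕ} (hm : m ≠ 0)
    (hn : 2 * n + 1 = Fintype.card F ^ m) : (n : E) ≠ 0 := by
  intro h
  have h1 : ((Fintype.card F : ℕ) : E) = 0 := by
    rw [← map_natCast (algebraMap F E), FiniteField.cast_card_eq_zero, map_zero]
  have h2 := congrArg (Nat.cast : ℕ → E) hn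
  push_cast at h2
  rw [h, h1, zero_pow hm] at h2
  norm_num at h2

lemma IsTraceWord.evalAt_self {m : ℕ} {γ a b : E} {c : Fin n → F}
    (hc : IsTraceWord m γ a b c) (hodd : Odd (Fintype.card F)) (h3 : 3 ≤ Fintype.card F)
    (hm : 2 ≤ m) (hn : 2 * n + 1 = Fintype.card F ^ m) (hγ : IsPrimitiveRoot γ (2 * n))
    (hγn : γ ^ n = -1) : evalAt F n γ c = n * a := by
  classical
  set q := Fintype.card F
  have hpow : ∀ k < m, 1 + q ^ k < 2 * n := by
    intro k hk
    obtain ⟨l, rfl⟩ : ∃ l, m = l + 2 := ⟨m - 2, by omega⟩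
    have h1 : q ^ k ≤ q ^ (l + 1) := Nat.pow_le_pow_right (by omega) (by omega)
    have h2 : q ^ (l + 2) = q ^ (l + 1) * q := pow_succ _ _
    have h4 : q ^ (l + 1) = q ^ l * q := pow_succ _ _
    have h5 : 0 < q ^ l := by positivity
    nlinarith
  have hγ0 : γ ≠ 0 := hγ.ne_zero (by have := hpow 0 (by omega); omega)
  rw [hc.evalAt_eq hodd hγn hγn hγ0, sum_eq_single 0]
  · have : γ ≠ γ⁻¹ := by
      intro h
      have h1 : γ ^ 2 = 1 := by
        rw [pow_two]
        nth_rewrite 2 [h]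
        exact mul_inv_cancel₀ hγ0
      have := Nat.le_of_dvd (by norm_num) ((hγ.pow_eq_one_iff_dvd 2).mp h1)
      have := hpow 0 (by omega)
      simp at this
      omega
    simp [this]
  · intro k hk hk0
    have hkm := hpow k (mem_range.mp hk)
    rw [if_neg, if_neg, add_zero]
    · intro h
      have h1 : γ ^ (1 + q ^ k) = 1 := by
        rw [pow_add, pow_one]
        nth_rewrite 1 [h]
        rw [inv_pow, inv_mul_cancel₀ (pow_ne_zero _ hγ0)]
      have := Nat.le_of_dvd (by omega) ((hγ.pow_eq_one_iff_dvd _).mp h1)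
      omega
    · intro h
      have := hγ.pow_inj (i := 1) (j := q ^ k) (by omega) (by omega) (by rwa [pow_one])
      have := Nat.one_lt_pow hk0 (show 1 < q by omega)
      omega
  · intro h
    simp at h
    omega

/-- The code whose nonzeros are the conjugates of `γ` and `γ⁻¹` has dimension `2 * m`, and its dual
consists of the words vanishing at `γ` and `γ⁻¹`. -/
lemma finrank_and_mem_dualCode {m : ℕ} {γ : E} {C : Submodule F (Fin n → F)}
    (hC : ∀ c, c ∈ C ↔ ∀ x : E, x ^ n = -1 → (∀ k : ℕ, x ≠ γ ^ (Fintype.card F ^ k)) →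
      (∀ k : ℕ, x ≠ γ⁻¹ ^ (Fintype.card F ^ k)) → evalAt F n x c = 0)
    (hodd : Odd (Fintype.card F)) (h3 : 3 ≤ Fintype.card F)
    (hm : 2 ≤ m) (hn : 2 * n + 1 = Fintype.card F ^ m) (hγ : IsPrimitiveRoot γ (2 * n))
    (hn0 : 0 < n) (hγn : γ ^ n = -1) :
    Module.finrank F C = 2 * m ∧
      ∀ y, y ∈ dualCode C ↔ evalAt F n γ y = 0 ∧ evalAt F n γ⁻¹ y = 0 := by
  classical
  obtain ⟨hfin, hrank⟩ := finrank_frobFixed F hγ hn0 hn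
  set K := frobFixed F E m with hK
  have : Finite K := Module.finite_of_finite F
  have hγ0 : γ ≠ 0 := hγ.ne_zero (by omega)
  have hnE : (n : E) ≠ 0 := natCast_ne_zero_of_two_mul_add_one (F := F) (by omega) hn
  have hγi : γ⁻¹ ^ n = -1 := by rw [inv_pow, hγn, inv_neg, inv_one]
  have hγQ : γ ^ (Fintype.card F ^ m) = γ := by
    rw [← hn, pow_succ, hγ.pow_eq_one, one_mul]
  have hγiQ : γ⁻¹ ^ (Fintype.card F ^ m) = γ⁻¹ := by rw [inv_pow, hγQ]
  have hev : ∀ x : E, x ^ (Fintype.card F ^ m) = x → ∀ c : Fin n → F, evalAt F n x c ∈ K := by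
    intro x hx c
    rw [hK, mem_frobFixed, ← evalAt_pow_card_pow, hx]
  let S : (Fin n → F) →ₗ[F] K × K :=
    ((evalAt F n γ).codRestrict K (hev γ hγQ)).prod ((evalAt F n γ⁻¹).codRestrict K (hev _ hγiQ))
  have hS : ∀ c, S c = 0 ↔ evalAt F n γ c = 0 ∧ evalAt F n γ⁻¹ c = 0 := by
    intro c
    simp [S, Prod.ext_iff, Subtype.ext_iff]
  have hKK : Module.finrank F (K × K) = 2 * m := by
    rw [Module.finrank_prod, hrank, two_mul]
  have hSC : Function.Injective (S.comp C.subtype) := by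
    rw [← LinearMap.ker_eq_bot, LinearMap.ker_eq_bot']
    rintro ⟨c, hc⟩ h
    obtain ⟨h1, h2⟩ := (hS c).mp h
    refine Subtype.ext (eq_zero_of_evalAt_eq_zero_of_pow_eq_neg_one hγ hn0 hγn fun x hx => ?_)
    have hq0 : ∀ k, Fintype.card F ^ k ≠ 0 := fun k => pow_ne_zero _ (by omega)
    by_cases hx1 : ∃ k : ℕ, x = γ ^ (Fintype.card F ^ k)
    · obtain ⟨k, rfl⟩ := hx1
      rw [evalAt_pow_card_pow, h1, zero_pow (hq0 k)]
    by_cases hx2 : ∃ k : ℕ, x = γ⁻¹ ^ (Fintype.card F ^ k)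
    · obtain ⟨k, rfl⟩ := hx2
      rw [evalAt_pow_card_pow, h2, zero_pow (hq0 k)]
    · push Not at hx1 hx2
      exact (hC c).mp hc x hx hx1 hx2
  have hex : ∀ p : K × K, ∃ c : C, IsTraceWord m γ (p.1 : E) p.2 c.1 := by
    rintro ⟨⟨a, ha⟩, ⟨b, hb⟩⟩
    obtain ⟨c, hc⟩ := exists_isTraceWord (n := n) ((mem_frobFixed F).mpr hγQ) ha hb
    refine ⟨⟨c, (hC c).mpr fun x hx h1 h2 => ?_⟩, hc⟩
    rw [hc.evalAt_eq hodd hγn hx hγ0]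
    simp only [h1, h2, if_false, add_zero, sum_const_zero, mul_zero]
  choose T hT using hex
  have hTinj : Function.Injective T := by
    intro p p' h
    have e1 := (hT p).evalAt_self hodd h3 hm hn hγ hγn
    have e2 := (hT p).symm.evalAt_self hodd h3 hm hn hγ.inv hγi
    rw [h] at e1 e2
    rw [(hT p').evalAt_self hodd h3 hm hn hγ hγn] at e1
    rw [(hT p').symm.evalAt_self hodd h3 hm hn hγ.inv hγi] at e2
    exact Prod.ext (Subtype.ext (mul_left_cancel₀ hnE e1.symm))
      (Subtype.ext (mul_left_cancel₀ hnE e2.symm))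
  have hrC : Module.finrank F C = 2 * m := by
    refine le_antisymm (hKK ▸ LinearMap.finrank_le_finrank_of_injective hSC) ?_
    have := Nat.card_le_card_of_injective T hTinj
    rw [Module.natCard_eq_pow_finrank (K := F), Module.natCard_eq_pow_finrank (K := F) (V := C),
      hKK, Nat.card_eq_fintype_card] at this
    exact (Nat.pow_le_pow_iff_right (by omega)).mp this
  have hTsurj : Function.Surjective T := by
    refine (hTinj.bijective_of_nat_card_le ?_).2
    rw [Module.natCard_eq_pow_finrank (K := F), Module.natCard_eq_pow_finrank (K := F)
      (V := K × K), hKK, hrC]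
  refine ⟨hrC, ?_⟩
  have hle : LinearMap.ker S ≤ dualCode C := by
    intro y hy c hc
    obtain ⟨hy1, hy2⟩ := (hS y).mp hy
    obtain ⟨p, hp⟩ := hTsurj ⟨c, hc⟩
    have hw := hT p
    rw [hp] at hw
    apply (algebraMap F E).injective
    rw [map_zero, map_sum]
    simp only [map_mul]
    have hw' : ∀ j, algebraMap F E (c j) = _ := hw
    simp_rw [hw', mul_sum]
    rw [sum_comm]
    refine sum_eq_zero fun k _ => ?_
    have hyF : ∀ j, algebraMap F E (y j) = algebraMap F E (y j) ^ (Fintype.card F ^ k) := by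
      intro j
      rw [← map_pow, FiniteField.pow_card_pow]
    calc _ = ∑ j : Fin n, (algebraMap F E (y j) *
          ((p.1 : E) * γ⁻¹ ^ (j : ℕ) + p.2 * γ ^ (j : ℕ))) ^ (Fintype.card F ^ k) := by
            refine sum_congr rfl fun j _ => ?_
            rw [mul_pow, ← hyF]
      _ = (p.1 * evalAt F n γ⁻¹ y + p.2 * evalAt F n γ y) ^ (Fintype.card F ^ k) := by
            rw [← sum_pow_card_pow, evalAt_apply, evalAt_apply, mul_sum, mul_sum,
              ← sum_add_distrib]
            congr 1
            refine sum_congr rfl fun j _ => ?_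
            ring
      _ = 0 := by
            rw [hy1, hy2, mul_zero, mul_zero, add_zero, zero_pow (pow_ne_zero _ (by omega))]
  have heq : LinearMap.ker S = dualCode C := by
    refine Submodule.eq_of_le_of_finrank_le hle ?_
    rw [finrank_dualCode, hrC]
    have h1 := LinearMap.finrank_range_add_finrank_ker S
    have h2 := Submodule.finrank_le (LinearMap.range S)
    rw [Module.finrank_fin_fun] at h1
    omega
  intro y
  rw [← heq, LinearMap.mem_ker, hS]

end

section
variable {F E : Type*} [Field F] [Field E] [Algebra F E] {n : ℕ}

lemma three_le_hWt {γ : E} (hγ : IsPrimitiveRoot γ (2 * n)) (hn0 : 0 < n) {c : Fin n → F}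
    (hc0 : c ≠ 0) (h1 : evalAt F n γ c = 0) (h2 : evalAt F n γ⁻¹ c = 0) : 3 ≤ hWt c := by
  by_contra! hlt
  refine hc0 (eq_zero_of_evalAt_geometric_eq_zero (x := γ⁻¹) (y := γ ^ 2)
    (inv_ne_zero (hγ.ne_zero (by omega))) ?_ c fun t ht => ?_)
  · intro i j hij
    simp only [← pow_mul] at hij
    have := hγ.pow_inj (by omega) (by omega) hij
    omega
  · have hγ0 : γ ≠ 0 := hγ.ne_zero (by omega)
    obtain rfl | rfl : t = 0 ∨ t = 1 := by omega
    · simpa using h2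
    · rw [show γ⁻¹ * (γ ^ 2) ^ 1 = γ by field_simp]
      exact h1

/-- Words with entry `a` at `0`, and `u`, `w` at two further ordered positions. -/
def threeTermWord (n : ℕ) (p : (Σ j : Fin (n - 1), Fin j) × Fˣ × Fˣ × F) (l : Fin n) : F :=
  if (l : ℕ) = 0 then p.2.2.2 else if (l : ℕ) = p.1.2 + 1 then p.2.1 else
    if (l : ℕ) = p.1.1 + 1 then p.2.2.1 else 0

lemma threeTermWord_injective (hn0 : 0 < n) :
    Function.Injective (threeTermWord (F := F) n) := by
  rintro ⟨⟨⟨j, hj⟩, ⟨i, hi⟩⟩, u, w, a⟩ ⟨⟨⟨j', hj'⟩, ⟨i', hi'⟩⟩, u', w', a'⟩ h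
  simp only at hi hi'
  have hval : ∀ l (hl : l < n), _ := fun l hl => congrFun h ⟨l, hl⟩
  simp only [threeTermWord] at hval
  have h0 := hval 0 hn0
  have hi1 := hval (i + 1) (by omega)
  have hj1 := hval (j + 1) (by omega)
  have hi2 := hval (i' + 1) (by omega)
  have hj2 := hval (j' + 1) (by omega)
  simp only [Nat.add_eq_zero_iff, one_ne_zero, and_false, if_false, if_true, add_left_inj]
    at h0 hi1 hj1 hi2 hj2
  obtain rfl : i = i' := by
    by_contra hne
    have h1 : i = j' := by
      by_contra h'
      simp [hne, h'] at hi1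
    have h2 : i' = j := by
      by_contra h'
      simp [Ne.symm hne, h', eq_comm] at hi2
    omega
  obtain rfl : j = j' := by
    by_contra hne
    simp [hne, show j ≠ i by omega] at hj1
  have hij : j ≠ i := by omega
  simp only [hij, if_true, if_false, Units.val_inj] at hi1 hj1
  rw [h0, hi1, hj1]

lemma hWt_sub_threeTermWord_le (p p' : (Σ j : Fin (n - 1), Fin j) × Fˣ × Fˣ × F) :
    hWt (threeTermWord n p - threeTermWord n p') ≤ 5 := by
  classical
  rw [hWt_eq_card, ← card_image_of_injective _ Fin.val_injective]
  refine (card_le_card (t := {0, (p.1.2 : ℕ) + 1, (p.1.1 : ℕ) + 1, (p'.1.2 : ℕ) + 1,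
    (p'.1.1 : ℕ) + 1}) ?_).trans card_le_five
  intro l hl
  simp only [mem_image, mem_filter, mem_univ, true_and, Pi.sub_apply] at hl
  obtain ⟨l, hne, rfl⟩ := hl
  by_contra hl
  simp only [mem_insert, mem_singleton, not_or] at hl
  obtain ⟨h0, h1, h2, h3, h4⟩ := hl
  simp [threeTermWord, h0, h1, h2, h3, h4] at hne

lemma natCard_sigma_fin (k : ℕ) : Nat.card (Σ j : Fin k, Fin j) * 2 = k * (k - 1) := by
  rw [Nat.card_eq_fintype_card, Fintype.card_sigma]
  simp only [Fintype.card_fin]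
  rw [Fin.sum_univ_eq_sum_range fun i => i, sum_range_id_mul_two]

/-- A linear map with small enough image has a nonzero word of weight at most `5` in its kernel. -/
lemma exists_hWt_le_five [Fintype F] {V : Type*} [AddCommGroup V] [Module F V] [Finite V]
    (f : (Fin n → F) →ₗ[F] V) (hn0 : 0 < n) {Q : ℕ} (hV : Nat.card V = Q ^ 2)
    (hQ : 2 * n + 1 = Q) (hQ27 : 27 ≤ Q) (h3 : 3 ≤ Fintype.card F) :
    ∃ c, c ≠ 0 ∧ f c = 0 ∧ hWt c ≤ 5 := by
  classical
  have hcard : Nat.card V < Nat.card ((Σ j : Fin (n - 1), Fin j) × Fˣ × Fˣ × F) := by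
    have hs := natCard_sigma_fin (n - 1)
    rw [Nat.card_prod, Nat.card_prod, Nat.card_prod, hV, Nat.card_eq_fintype_card (α := F),
      Nat.card_units, Nat.card_eq_fintype_card (α := F)]
    obtain ⟨r, hr⟩ : ∃ r, Fintype.card F = r + 3 := ⟨_, (Nat.sub_add_cancel h3).symm⟩
    generalize Nat.card (Σ j : Fin (n - 1), Fin j) = N at hs ⊢
    obtain ⟨t, ht⟩ : ∃ t, n = t + 13 := ⟨n - 13, by omega⟩
    rw [hr]
    subst ht hQ
    simp only [show t + 13 - 1 = t + 12 by omega, show t + 12 - 1 = t + 11 by omega] at hs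
    simp only [show r + 3 - 1 = r + 2 by omega]
    have h12 : 2 * (2 * 3) ≤ (r + 2) * ((r + 2) * (r + 3)) := by gcongr <;> omega
    calc _ < N * 12 := by nlinarith
      _ ≤ _ := Nat.mul_le_mul_left _ h12
  have hninj : ¬ Function.Injective fun p : (Σ j : Fin (n - 1), Fin j) × Fˣ × Fˣ × F =>
      f (threeTermWord n p) := fun h => hcard.not_ge (Nat.card_le_card_of_injective _ h)
  obtain ⟨p, p', hpp, hne⟩ := Function.not_injective_iff.mp hninj
  refine ⟨threeTermWord n p - threeTermWord n p', ?_, ?_, hWt_sub_threeTermWord_le p p'⟩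
  · exact sub_ne_zero.mpr fun h => hne (threeTermWord_injective hn0 h)
  · rw [map_sub, sub_eq_zero]
    exact hpp

end

/-- Membership in the union of the cosets of `1` and of `q ^ m - q ^ (m - 1) - 1`, which is the
coset of `-1`, in terms of powers of a primitive root. -/
lemma mem_qCoset_union_iff {E : Type*} [Field E] {q m n : ℕ} {γ : E} (hn0 : 0 < n) (hm : m ≠ 0)
    (hq : 1 < q) (hn : 2 * n + 1 = q ^ m) (hγ : IsPrimitiveRoot γ (2 * n)) (hγ0 : γ ≠ 0) (s : ℕ) :
    (s : ZMod (2 * n)) ∈ qCoset q (2 * n) 1 ∪ qCoset q (2 * n) (q ^ m - q ^ (m - 1) - 1) ↔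
      (∃ k : ℕ, γ ^ s = γ ^ (q ^ k)) ∨ ∃ k : ℕ, γ ^ s = γ⁻¹ ^ (q ^ k) := by
  have hqm : (q : ZMod (2 * n)) ^ m = 1 := by
    have := congrArg (Nat.cast : ℕ → ZMod (2 * n)) hn
    simpa using this.symm
  have hδ : ((q ^ m - q ^ (m - 1) - 1 : ℕ) : ZMod (2 * n)) = -(q : ZMod (2 * n)) ^ (m - 1) := by
    have hlt : q ^ (m - 1) < q ^ m := Nat.pow_lt_pow_right (by omega) (by omega)
    have h : (q ^ m - q ^ (m - 1) - 1) + q ^ (m - 1) + 1 = q ^ m := by omega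
    have := congrArg (Nat.cast : ℕ → ZMod (2 * n)) h
    push_cast at this
    rw [hqm] at this
    linear_combination this
  have h1 : ∀ a b : ℕ, γ ^ a = γ ^ b ↔ (a : ZMod (2 * n)) = b := by
    intro a b
    rw [ZMod.natCast_eq_natCast_iff, hγ.eq_orderOf]
    exact (isOfFinOrder_iff_pow_eq_one.mpr ⟨_, by omega, hγ.pow_eq_one⟩).pow_eq_pow_iff_modEq
  have h2 : ∀ a b : ℕ, γ ^ a = γ⁻¹ ^ b ↔ (a : ZMod (2 * n)) = -b := by
    intro a b
    rw [inv_pow, ← mul_eq_one_iff_eq_inv₀ (pow_ne_zero _ hγ0), ← pow_add, hγ.pow_eq_one_iff_dvd,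
      ← ZMod.natCast_eq_zero_iff, Nat.cast_add, eq_neg_iff_add_eq_zero]
  have hq1 : (q : ZMod (2 * n)) ^ (m - 1) * q = 1 := by
    rw [← pow_succ, Nat.sub_add_cancel (by omega), hqm]
  simp only [h1, h2, Set.mem_union, qCoset, Set.mem_range, hδ, Nat.cast_one, one_mul, Nat.cast_pow]
  refine or_congr (exists_congr fun _ => eq_comm) ⟨?_, ?_⟩
  · rintro ⟨j, hj⟩
    exact ⟨m - 1 + j, by rw [← hj, pow_add, neg_mul]⟩
  · rintro ⟨k, hk⟩
    refine ⟨k + 1, ?_⟩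
    rw [hk, pow_succ]
    linear_combination (-(q : ZMod (2 * n)) ^ k) * hq1

theorem stmt_11 (q m n : ℕ)
    (hq : ∃ p e : ℕ, p.Prime ∧ Odd p ∧ 0 < e ∧ q = p ^ e)
    (hq3 : 3 ≤ q) (hm : 3 ≤ m) (hn : 2 * n = q ^ m - 1)
    (F E : Type*) [Field F] [Fintype F] [Field E] [Algebra F E]
    (hF : Fintype.card F = q)
    (γ : E) (hγ : IsPrimitiveRoot γ (2 * n))
    (C' : Submodule F (Fin n → F))
    (hC' : C' = ⨅ s ∈ {s : ℕ | s < 2 * n ∧ Odd s ∧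
        (s : ZMod (2 * n)) ∉ qCoset q (2 * n) 1 ∪ qCoset q (2 * n) (q ^ m - q ^ (m - 1) - 1)},
      LinearMap.ker (evalAt F n (γ ^ s))) :
    Module.finrank F C' = 2 * m ∧
    (∀ c ∈ C', c ≠ 0 → ((q - 2) * q ^ (m - 1) - 1) / 2 ≤ hWt c) ∧
    Module.finrank F (dualCode C') = n - 2 * m ∧
    (∃ d, minDistIs (dualCode C') d ∧ 3 ≤ d ∧ d ≤ 5) := by
  classical
  subst hF
  set q := Fintype.card F with hqdef
  have hodd : Odd q := by
    obtain ⟨p, e, -, hp, -, he⟩ := hq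
    exact he ▸ hp.pow
  have hQ27 : 27 ≤ q ^ m := calc
    27 = 3 ^ 3 := by norm_num
    _ ≤ q ^ 3 := Nat.pow_le_pow_left hq3 3
    _ ≤ q ^ m := Nat.pow_le_pow_right (by omega) hm
  have hn1 : 2 * n + 1 = q ^ m := by omega
  have hn0 : 0 < n := by omega
  have hγ0 : γ ≠ 0 := hγ.ne_zero (by omega)
  have hγn : γ ^ n = -1 := by
    have h1 : (γ ^ n) ^ 2 = 1 := by rw [← pow_mul, mul_comm, hγ.pow_eq_one]
    refine (sq_eq_sq_iff_eq_or_eq_neg.mp (h1.trans (one_pow 2).symm)).resolve_left fun h => ?_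
    have := Nat.le_of_dvd hn0 ((hγ.pow_eq_one_iff_dvd n).mp h)
    omega
  have hone : (1 : E) ≠ -1 := by
    intro h
    have := (hγ.pow_eq_one_iff_dvd n).mp (hγn.trans h.symm)
    have := Nat.le_of_dvd hn0 this
    omega
  have hpowodd : ∀ s : ℕ, (γ ^ s) ^ n = -1 ↔ Odd s := by
    intro s
    rw [← pow_mul, mul_comm, pow_mul, hγn]
    rcases Nat.even_or_odd s with h | h
    · simp [h.neg_one_pow, hone, h]
    · simp [h.neg_one_pow, h]
  have hC : ∀ c, c ∈ C' ↔ ∀ x : E, x ^ n = -1 → (∀ k : ℕ, x ≠ γ ^ (q ^ k)) →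
      (∀ k : ℕ, x ≠ γ⁻¹ ^ (q ^ k)) → evalAt F n x c = 0 := by
    intro c
    rw [hC']
    simp only [Submodule.mem_iInf, LinearMap.mem_ker, Set.mem_ofPred_eq,
      mem_qCoset_union_iff hn0 (by omega : m ≠ 0) (by omega : 1 < q) hn1 hγ hγ0]
    constructor
    · intro h x hx h1 h2
      have : NeZero (2 * n) := ⟨by omega⟩
      obtain ⟨s, hs, rfl⟩ := hγ.eq_pow_of_pow_eq_one (ξ := x)
        (by rw [mul_comm, pow_mul, hx, neg_one_sq])
      refine h s ⟨hs, (hpowodd s).mp hx, ?_⟩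
      rintro (⟨k, hk⟩ | ⟨k, hk⟩)
      · exact h1 k hk
      · exact h2 k hk
    · rintro h s ⟨-, hs, hns⟩
      push Not at hns
      exact h _ ((hpowodd s).mpr hs) hns.1 hns.2
  obtain ⟨hrank, hdual⟩ :=
    finrank_and_mem_dualCode hC hodd hq3 (by omega) hn1 hγ hn0 hγn
  refine ⟨hrank, ?_, by rw [finrank_dualCode, hrank], ?_⟩
  · intro c hc hc0
    by_contra! hlt
    refine hc0 (eq_zero_of_evalAt_geometric_eq_zero (x := γ ^ (q ^ (m - 1) + 2)) (y := γ ^ 2)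
      (pow_ne_zero _ hγ0) ?_ c fun t ht => ?_)
    · intro i j hij
      simp only [← pow_mul] at hij
      have := hγ.pow_inj (by omega) (by omega) hij
      omega
    have hQ : q ^ m = (q - 2) * q ^ (m - 1) + 2 * q ^ (m - 1) := by
      rw [← add_mul, Nat.sub_add_cancel (by omega), ← pow_succ', Nat.sub_add_cancel (by omega)]
    generalize hB : (q - 2) * q ^ (m - 1) = B at hlt hQ
    rw [← pow_mul, ← pow_add]
    set s := q ^ (m - 1) + 2 + 2 * t with hs
    have hlead : ∀ k : ℕ, ∃ l : ℕ, q ^ l ≤ q ^ (m - 1) ∧ γ ^ (q ^ k) = γ ^ (q ^ l) := by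
      intro k
      refine ⟨k % m, Nat.pow_le_pow_right (by omega)
        (Nat.le_sub_one_of_lt (Nat.mod_lt _ (by omega))), ?_⟩
      have hfix : ∀ d : ℕ, γ ^ ((q ^ m) ^ d) = γ := by
        intro d
        induction d with
        | zero => simp
        | succ d ih => rw [pow_succ, pow_mul, ih, ← hn1, pow_succ, hγ.pow_eq_one, one_mul]
      nth_rewrite 1 [← Nat.mod_add_div k m]
      rw [pow_add, pow_mul q m, mul_comm, pow_mul, hfix]
    refine (hC c).mp hc _ ((hpowodd s).mpr ?_) ?_ ?_
    · rw [hs, add_assoc, ← mul_one_add]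
      exact hodd.pow.add_even (even_two_mul _)
    · intro k hk
      obtain ⟨l, hl, hkl⟩ := hlead k
      have := hγ.pow_inj (by omega) (by omega) (hk.trans hkl)
      omega
    · intro k hk
      obtain ⟨l, hl, hkl⟩ := hlead k
      rw [inv_pow, hkl, ← mul_eq_one_iff_eq_inv₀ (pow_ne_zero _ hγ0), ← pow_add,
        hγ.pow_eq_one_iff_dvd] at hk
      have := Nat.le_of_dvd (by omega) hk
      omega
  · have hge : ∀ c ∈ dualCode C', c ≠ 0 → 3 ≤ hWt c := fun c hc hc0 =>
      three_le_hWt hγ hn0 hc0 ((hdual c).mp hc).1 ((hdual c).mp hc).2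
    have : Finite ((Fin n → F) ⧸ dualCode C') := Module.finite_of_finite F
    have hquot : Nat.card ((Fin n → F) ⧸ dualCode C') = (q ^ m) ^ 2 := by
      have h1 := Submodule.finrank_quotient_add_finrank (dualCode C')
      have h2 := Submodule.finrank_le C'
      rw [finrank_dualCode] at h1
      rw [Module.finrank_fin_fun] at h1 h2
      rw [Module.natCard_eq_pow_finrank (K := F), Nat.card_eq_fintype_card, ← pow_mul,
        mul_comm m 2, ← hrank]
      congr 1
      omega
    obtain ⟨c, hc0, hc, hc5⟩ :=
      exists_hWt_le_five (dualCode C').mkQ hn0 hquot hn1 hQ27 hq3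
    rw [Submodule.mkQ_apply, Submodule.Quotient.mk_eq_zero] at hc
    have hmem : hWt c ∈ {w : ℕ | ∃ c ∈ dualCode C', c ≠ 0 ∧ hWt c = w} := ⟨c, hc, hc0, rfl⟩
    obtain ⟨c', hc', hc0', hw⟩ := Nat.sInf_mem ⟨_, hmem⟩
    exact ⟨_, ⟨Nat.sInf_mem ⟨_, hmem⟩, fun _ h => Nat.sInf_le h⟩, hw ▸ hge c' hc' hc0',
      (Nat.sInf_le hmem).trans hc5⟩
end
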